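/- Let d ≥ 1, s ∈ (1,2] and L > 0. If f : ℝ^d → ℝ is nonnegative and continuously differentiable with ‖∇f(x) − ∇f(y)‖ ≤ L‖x−y‖^{s−1} for all x, y ∈ ℝ^d, then for every x ∈ ℝ^d and every t > 0, |f_t(x) − f(x)| ≤ d L t^s / (s + d). -/

import Mathlib

open MeasureTheory Real

noncomputable section

abbrev Euc (d : ℕ) : Type := EuclideanSpace ℝ (Fin d)

/-- Volume of the unit Euclidean ball in `ℝ^d`. -/
def unitBallVol (d : ℕ) : ℝ := Real.pi ^ ((d : ℝ) / 2) / Real.Gamma (1 + (d : ℝ) / 2)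

/-- `f_t(x)`: the average of `f` over the closed Euclidean ball `B(x,t)`. -/
def ballAvg (d : ℕ) (f : Euc d → ℝ) (t : ℝ) (x : Euc d) : ℝ :=
  (1 / (unitBallVol d * t ^ d)) * ∫ u in Metric.closedBall x t, f u

end

noncomputable section

open Module in
/-- The integral of `‖v‖ ^ s` over the ball of radius `t`, in polar coordinates. -/
theorem setIntegral_closedBall_norm_rpow {E : Type*} [NormedAddCommGroup E] [NormedSpace ℝ E]
    [FiniteDimensional ℝ E] [Nontrivial E] [MeasurableSpace E] [BorelSpace E]
    (μ : Measure E) [μ.IsAddHaarMeasure] {s t : ℝ} (hs : 0 ≤ s) (ht : 0 ≤ t) :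
    ∫ v in Metric.closedBall (0 : E) t, ‖v‖ ^ s ∂μ =
      finrank ℝ E * μ.real (Metric.ball 0 1) *
        (t ^ (s + finrank ℝ E) / (s + finrank ℝ E)) := by
  have hdim : 1 ≤ finrank ℝ E := finrank_pos
  have hball (v : E) : (Metric.closedBall (0 : E) t).indicator (fun v => ‖v‖ ^ s) v =
      (Set.Iic t).indicator (fun r : ℝ => r ^ s) ‖v‖ := by
    by_cases hv : ‖v‖ ≤ t <;> simp [hv]
  have hradial : ∫ r in Set.Ioi (0 : ℝ),
      r ^ (finrank ℝ E - 1) • (Set.Iic t).indicator (fun r : ℝ => r ^ s) r =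
      t ^ (s + finrank ℝ E) / (s + finrank ℝ E) := by
    have hpow : ∀ r ∈ Set.Ioi (0 : ℝ),
        r ^ (finrank ℝ E - 1) • (Set.Iic t).indicator (fun r : ℝ => r ^ s) r =
        (Set.Iic t).indicator (fun r : ℝ => r ^ (s + finrank ℝ E - 1)) r := by
      intro r hr
      by_cases hrt : r ∈ Set.Iic t
      · rw [Set.indicator_of_mem hrt, Set.indicator_of_mem hrt, smul_eq_mul, ← rpow_natCast,
          ← rpow_add hr, Nat.cast_sub hdim]
        congr 1
        push_cast
        ring
      · simp [Set.indicator_of_notMem hrt]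
    have hpos : (1 : ℝ) ≤ finrank ℝ E := by exact_mod_cast hdim
    rw [setIntegral_congr_fun measurableSet_Ioi hpow, setIntegral_indicator measurableSet_Iic,
      Set.Ioi_inter_Iic, ← intervalIntegral.integral_of_le ht,
      integral_rpow (Or.inl (by linarith)), sub_add_cancel, zero_rpow (by linarith), sub_zero]
  rw [← integral_indicator Metric.isClosed_closedBall.measurableSet]
  simp_rw [hball]
  rw [integral_fun_norm_addHaar μ, hradial, nsmul_eq_mul, smul_eq_mul, mul_assoc]

theorem unitBallVol_pos (d : ℕ) : 0 < unitBallVol d :=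
  div_pos (rpow_pos_of_pos pi_pos _) (Gamma_pos_of_pos (by positivity))

theorem volume_real_closedBall {d : ℕ} (hd : 1 ≤ d) (x : Euc d) {t : ℝ} (ht : 0 ≤ t) :
    volume.real (Metric.closedBall x t) = unitBallVol d * t ^ d := by
  have : Nonempty (Fin d) := ⟨⟨0, hd⟩⟩
  have hsqrt : √π ^ d = π ^ ((d : ℝ) / 2) := by
    rw [sqrt_eq_rpow, ← rpow_natCast, ← rpow_mul pi_pos.le]
    congr 1
    ring
  have hvol : √π ^ d / Gamma ((d : ℝ) / 2 + 1) = unitBallVol d := by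
    rw [hsqrt, unitBallVol, add_comm]
  rw [Measure.real, EuclideanSpace.volume_closedBall, Fintype.card_fin, hvol, ENNReal.toReal_mul,
    ENNReal.toReal_pow, ENNReal.toReal_ofReal ht, ENNReal.toReal_ofReal (unitBallVol_pos d).le,
    mul_comm]

theorem volume_real_unit_ball {d : ℕ} (hd : 1 ≤ d) :
    volume.real (Metric.ball (0 : Euc d) 1) = unitBallVol d := by
  have : Nonempty (Fin d) := ⟨⟨0, hd⟩⟩
  have : Nontrivial (Euc d) := inferInstanceAs (Nontrivial (EuclideanSpace ℝ (Fin d)))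
  have h := volume_real_closedBall hd 0 zero_le_one
  rwa [one_pow, mul_one, Measure.real, Measure.addHaar_closedBall_eq_addHaar_ball] at h

/-- A continuous linear functional has integral zero over a ball centred at the origin. -/
theorem setIntegral_closedBall_zero_continuousLinearMap {E : Type*} [NormedAddCommGroup E]
    [NormedSpace ℝ E] [MeasurableSpace E] [BorelSpace E] (μ : Measure E) [μ.IsNegInvariant]
    (φ : E →L[ℝ] ℝ) (t : ℝ) : ∫ v in Metric.closedBall (0 : E) t, φ v ∂μ = 0 := by
  rw [← integral_indicator Metric.isClosed_closedBall.measurableSet]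
  set g := (Metric.closedBall (0 : E) t).indicator (fun v => φ v) with hg
  have hodd (v : E) : g (-v) = -g v := by
    by_cases hv : ‖v‖ ≤ t <;> simp [hg, hv]
  have h := integral_neg_eq_self g μ
  simp_rw [hodd, integral_neg] at h
  linarith

/-- First-order Taylor estimate for a function with Hölder continuous gradient. -/
theorem abs_sub_sub_fderiv_le_of_gradient_holder {E : Type*} [NormedAddCommGroup E]
    [InnerProductSpace ℝ E] [CompleteSpace E] {f : E → ℝ} {s L : ℝ} (hs : 1 < s) (hL : 0 ≤ L)
    (hdiff : Differentiable ℝ f)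
    (hgrad : ∀ x y : E, ‖gradient f x - gradient f y‖ ≤ L * ‖x - y‖ ^ (s - 1)) (x v : E) :
    |f (x + v) - f x - fderiv ℝ f x v| ≤ L * ‖v‖ ^ s := by
  have hbound : ∀ y ∈ Metric.closedBall x ‖v‖,
      ‖fderiv ℝ f y - fderiv ℝ f x‖ ≤ L * ‖v‖ ^ (s - 1) := by
    intro y hy
    rw [← toDual_gradient, ← toDual_gradient, ← map_sub, LinearIsometryEquiv.norm_map]
    refine (hgrad y x).trans ?_
    have := mem_closedBall_iff_norm.mp hy
    gcongr
  have h := (convex_closedBall x ‖v‖).norm_image_sub_le_of_norm_fderiv_le' (y := x + v)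
    (fun y _ => hdiff y) hbound (Metric.mem_closedBall_self (norm_nonneg v)) (by simp)
  rw [add_sub_cancel_left, Real.norm_eq_abs] at h
  refine h.trans_eq ?_
  rw [mul_assoc, ← rpow_add_one' (norm_nonneg v) (by linarith), sub_add_cancel]

/-- For a nonnegative `C¹` function whose gradient is
`(s-1,L)`-Hölder, `s ∈ (1,2]`, the ball average satisfies
`|f_t(x) - f(x)| ≤ d L t^s/(s+d)`. -/
theorem ballAvg_sub_self_le_of_gradient_holder (d : ℕ) (hd : 1 ≤ d) (s L : ℝ)
    (hs : 1 < s) (hs2 : s ≤ 2) (hL : 0 < L)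
    (f : Euc d → ℝ) (hnonneg : ∀ x, 0 ≤ f x) (hdiff : ContDiff ℝ 1 f)
    (hgrad : ∀ x y : Euc d, ‖gradient f x - gradient f y‖ ≤ L * ‖x - y‖ ^ (s - 1))
    (x : Euc d) (t : ℝ) (ht : 0 < t) :
    |ballAvg d f t x - f x| ≤ d * L * t ^ s / (s + d) := by
  have : Nonempty (Fin d) := ⟨⟨0, hd⟩⟩
  set V := unitBallVol d * t ^ d with hV
  have hVpos : 0 < V := mul_pos (unitBallVol_pos d) (pow_pos ht d)
  have hcompact := isCompact_closedBall (0 : Euc d) t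
  have hshift : ∫ u in Metric.closedBall x t, f u =
      ∫ v in Metric.closedBall (0 : Euc d) t, f (x + v) := by
    rw [← integral_indicator Metric.isClosed_closedBall.measurableSet,
      ← integral_indicator Metric.isClosed_closedBall.measurableSet,
      ← integral_add_left_eq_self _ x]
    congr 1 with v
    by_cases hv : ‖v‖ ≤ t <;> simp [hv]
  have hf : IntegrableOn (fun v => f (x + v)) (Metric.closedBall (0 : Euc d) t) :=
    (hdiff.continuous.comp (continuous_const.add continuous_id)).continuousOn.integrableOn_compact
      hcompact
  have hconst : IntegrableOn (fun _ => f x) (Metric.closedBall (0 : Euc d) t) :=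
    continuousOn_const.integrableOn_compact hcompact
  have hlin : IntegrableOn (fun v => fderiv ℝ f x v) (Metric.closedBall (0 : Euc d) t) :=
    (fderiv ℝ f x).continuous.continuousOn.integrableOn_compact hcompact
  have hnorm : IntegrableOn (fun v => L * ‖v‖ ^ s) (Metric.closedBall (0 : Euc d) t) :=
    (continuous_const.mul (continuous_norm.rpow_const fun _ => Or.inr (by linarith))).continuousOn
      |>.integrableOn_compact hcompact
  have hremainder :
      ∫ v in Metric.closedBall (0 : Euc d) t, (f (x + v) - f x - fderiv ℝ f x v) =
        (∫ u in Metric.closedBall x t, f u) - V * f x := by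
    rw [integral_sub (by exact hf.sub hconst) hlin, integral_sub hf hconst,
      setIntegral_closedBall_zero_continuousLinearMap, sub_zero, setIntegral_const,
      volume_real_closedBall hd 0 ht.le, smul_eq_mul, hshift]
  have hle : |(∫ u in Metric.closedBall x t, f u) - V * f x| ≤
      V * (d * L * t ^ s / (s + d)) := by
    rw [← hremainder, ← Real.norm_eq_abs]
    refine (norm_integral_le_of_norm_le hnorm <| .of_forall fun v => ?_).trans_eq ?_
    · exact abs_sub_sub_fderiv_le_of_gradient_holder hs hL.le (hdiff.differentiable one_ne_zero)
        hgrad x v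
    rw [integral_const_mul, setIntegral_closedBall_norm_rpow volume (by linarith) ht.le,
      finrank_euclideanSpace_fin, volume_real_unit_ball hd, rpow_add ht, rpow_natCast, hV]
    ring
  have hdiv : ballAvg d f t x - f x =
      ((∫ u in Metric.closedBall x t, f u) - V * f x) / V := by
    rw [ballAvg, ← hV]
    field_simp
  rw [hdiv, abs_div, abs_of_pos hVpos, div_le_iff₀' hVpos]
  exact hle

end
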